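/- arXiv:1805.11960 — 3 statements merged into one kernel-verified Lean document; each statement's English description precedes it below -/
import Mathlib

section
/- For a Tychonoff space X with iw(X) = ℵ_0, the following are equivalent: (1) C_p(X) satisfies F_fin(𝒮, 𝒟); (2) X satisfies U_fin(Γ_F, Ω); (3) C_p(X) satisfies F_fin(Γ_0, Ω_0); (4) C_p(X) satisfies F_fin(𝒮, Ω_0). -/
open Set Filter Topology

universe u

/-- A zero-set: the preimage of `{0}` under some continuous real-valued function. -/
def IsZeroSet {X : Type u} [TopologicalSpace X] (Z : Set X) : Prop :=
  ∃ f : X → ℝ, Continuous f ∧ Z = f ⁻¹' {0}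

/-- A cozero-set: the complement of a zero-set. -/
def IsCozeroSet {X : Type u} [TopologicalSpace X] (U : Set X) : Prop :=
  IsZeroSet Uᶜ

/-- A γ-cover (no openness requirement): an infinite nontrivial cover such that every
point belongs to all but finitely many members. -/
def IsGammaCoverSets {X : Type u} (𝒰 : Set (Set X)) : Prop :=
  (univ : Set X) ∉ 𝒰 ∧ 𝒰.Infinite ∧ ⋃₀ 𝒰 = (univ : Set X) ∧
    ∀ x : X, {U ∈ 𝒰 | x ∉ U}.Finite

/-- An open γ-cover. -/
def IsOpenGammaCover {X : Type u} [TopologicalSpace X] (𝒰 : Set (Set X)) : Prop :=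
  (∀ U ∈ 𝒰, IsOpen U) ∧ IsGammaCoverSets 𝒰

/-- A γ_F-shrinkable γ-cover: a γ-cover of cozero-sets admitting a shrinking by zero-sets
which is again a γ-cover. -/
def IsGammaFCover {X : Type u} [TopologicalSpace X] (𝒰 : Set (Set X)) : Prop :=
  IsOpenGammaCover 𝒰 ∧ (∀ U ∈ 𝒰, IsCozeroSet U) ∧
    ∃ F : Set X → Set X, (∀ U ∈ 𝒰, IsZeroSet (F U) ∧ F U ⊆ U) ∧
      IsGammaCoverSets (F '' 𝒰)

/-- An ω-cover: a nontrivial open cover such that every finite subset of the space is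
contained in some member. -/
def IsOmegaCover {X : Type u} [TopologicalSpace X] (𝒰 : Set (Set X)) : Prop :=
  (∀ U ∈ 𝒰, IsOpen U) ∧ (univ : Set X) ∉ 𝒰 ∧ ⋃₀ 𝒰 = (univ : Set X) ∧
    ∀ K : Set X, K.Finite → ∃ U ∈ 𝒰, K ⊆ U

/-- The family contains a finite subcover. -/
def HasFinSubcover {X : Type u} (𝒰 : Set (Set X)) : Prop :=
  ∃ 𝓕 ⊆ 𝒰, 𝓕.Finite ∧ ⋃₀ 𝓕 = (univ : Set X)

/-- `U_fin(Γ_F, Ω)`. -/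
def UfinGammaFOmega (X : Type u) [TopologicalSpace X] : Prop :=
  ∀ 𝒰 : ℕ → Set (Set X), (∀ n, IsGammaFCover (𝒰 n)) →
    (∀ n, ¬ HasFinSubcover (𝒰 n)) →
    ∃ 𝓕 : ℕ → Set (Set X), (∀ n, 𝓕 n ⊆ 𝒰 n ∧ (𝓕 n).Finite) ∧
      IsOmegaCover (Set.range fun n => ⋃₀ 𝓕 n)

/-- `U_fin(Γ_F, Γ)`. -/
def UfinGammaFGamma (X : Type u) [TopologicalSpace X] : Prop :=
  ∀ 𝒰 : ℕ → Set (Set X), (∀ n, IsGammaFCover (𝒰 n)) →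
    (∀ n, ¬ HasFinSubcover (𝒰 n)) →
    ∃ 𝓕 : ℕ → Set (Set X), (∀ n, 𝓕 n ⊆ 𝒰 n ∧ (𝓕 n).Finite) ∧
      IsOpenGammaCover (Set.range fun n => ⋃₀ 𝓕 n)

/-- `U_fin(𝒪, Ω)`. -/
def UfinOOmega (X : Type u) [TopologicalSpace X] : Prop :=
  ∀ 𝒰 : ℕ → Set (Set X),
    (∀ n, (∀ U ∈ 𝒰 n, IsOpen U) ∧ ⋃₀ 𝒰 n = (univ : Set X)) →
    (∀ n, ¬ HasFinSubcover (𝒰 n)) →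
    ∃ 𝓕 : ℕ → Set (Set X), (∀ n, 𝓕 n ⊆ 𝒰 n ∧ (𝓕 n).Finite) ∧
      IsOmegaCover (Set.range fun n => ⋃₀ 𝓕 n)

/-- The Hurewicz property `U_fin(𝒪, Γ)`. -/
def HurewiczProperty (X : Type u) [TopologicalSpace X] : Prop :=
  ∀ 𝒰 : ℕ → Set (Set X),
    (∀ n, (∀ U ∈ 𝒰 n, IsOpen U) ∧ ⋃₀ 𝒰 n = (univ : Set X)) →
    ∃ 𝓕 : ℕ → Set (Set X), (∀ n, 𝓕 n ⊆ 𝒰 n ∧ (𝓕 n).Finite) ∧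
      ∀ x : X, {n : ℕ | x ∉ ⋃₀ 𝓕 n}.Finite

/- Function space notions.  `C_p(X)` is the set of continuous functions `X → ℝ` with
the topology of pointwise convergence, i.e. the topology inherited from the product
topology on `X → ℝ` (the default `Pi` topology instance). -/

/-- A sequentially dense subset of `C_p(X)`: every continuous function is the pointwise
limit of a sequence from `D`. -/
def SeqDenseCp {X : Type u} [TopologicalSpace X] (D : Set (X → ℝ)) : Prop :=
  (∀ f ∈ D, Continuous f) ∧ ∀ f : X → ℝ, Continuous f →
    ∃ g : ℕ → X → ℝ, (∀ n, g n ∈ D) ∧ Tendsto g atTop (𝓝 f)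

/-- A dense subset of `C_p(X)`: every neighborhood (in the topology of pointwise
convergence) of every continuous function meets `D`. -/
def DenseCp {X : Type u} [TopologicalSpace X] (D : Set (X → ℝ)) : Prop :=
  (∀ f ∈ D, Continuous f) ∧ ∀ f : X → ℝ, Continuous f →
    ∀ U ∈ 𝓝 f, (U ∩ D).Nonempty

/-- `C_p(X)` is separable. -/
def CpSeparable (X : Type u) [TopologicalSpace X] : Prop :=
  ∃ D : Set (X → ℝ), D.Countable ∧ DenseCp D

/-- `C_p(X)` is sequentially separable. -/
def CpSeqSeparable (X : Type u) [TopologicalSpace X] : Prop :=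
  ∃ D : Set (X → ℝ), D.Countable ∧ SeqDenseCp D

/-- `A ∈ Γ_0`: a countable set of continuous functions, not containing `0`, infinite,
converging to `0` (every neighborhood of `0` in the topology of pointwise convergence
contains all but finitely many elements of `A`). -/
def GammaZero {X : Type u} [TopologicalSpace X] (A : Set (X → ℝ)) : Prop :=
  A.Countable ∧ (∀ f ∈ A, Continuous f) ∧ (0 : X → ℝ) ∉ A ∧ A.Infinite ∧
    ∀ U ∈ 𝓝 (0 : X → ℝ), (A \ U).Finite

/-- `C_p(X)` satisfies `F_fin(𝒮, 𝒟)`. -/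
def FfinSD (X : Type u) [TopologicalSpace X] : Prop :=
  ∀ S : ℕ → Set (X → ℝ), (∀ n, SeqDenseCp (S n)) →
    ∃ F : ℕ → Set (X → ℝ), (∀ n, F n ⊆ S n ∧ (F n).Finite) ∧
      ∀ f : X → ℝ, Continuous f → ∀ ε : ℝ, 0 < ε → ∀ K : Set X, K.Finite →
        ∃ n : ℕ, ∀ x ∈ K, ∃ h ∈ F n, |f x - h x| < ε

/-- `C_p(X)` satisfies `F_fin(Γ_0, Ω_0)`. -/
def FfinGammaOmega (X : Type u) [TopologicalSpace X] : Prop :=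
  ∀ S : ℕ → Set (X → ℝ), (∀ n, GammaZero (S n)) →
    ∃ F : ℕ → Set (X → ℝ), (∀ n, F n ⊆ S n ∧ (F n).Finite) ∧
      ∀ ε : ℝ, 0 < ε → ∀ K : Set X, K.Finite →
        ∃ n : ℕ, ∀ x ∈ K, ∃ h ∈ F n, |h x| < ε

/-- `C_p(X)` satisfies `F_fin(𝒮, Ω_0)`. -/
def FfinSOmega (X : Type u) [TopologicalSpace X] : Prop :=
  ∀ S : ℕ → Set (X → ℝ), (∀ n, SeqDenseCp (S n)) →
    ∃ F : ℕ → Set (X → ℝ), (∀ n, F n ⊆ S n ∧ (F n).Finite) ∧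
      ∀ ε : ℝ, 0 < ε → ∀ K : Set X, K.Finite →
        ∃ n : ℕ, ∀ x ∈ K, ∃ h ∈ F n, |h x| < ε

/-- `C_p(X)` satisfies `F_fin(𝒮, 𝒮)`. -/
def FfinSS (X : Type u) [TopologicalSpace X] : Prop :=
  ∀ S : ℕ → Set (X → ℝ), (∀ n, SeqDenseCp (S n)) →
    ∃ F : ℕ → Set (X → ℝ), (∀ n, F n ⊆ S n ∧ (F n).Finite) ∧
      ∀ f : X → ℝ, Continuous f → ∀ ε : ℝ, 0 < ε → ∀ K : Set X, K.Finite →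
        ∃ n' : ℕ, ∀ n : ℕ, n' < n → ∀ x ∈ K, ∃ h ∈ F n, |f x - h x| < ε

/-- `C_p(X)` satisfies `F_fin(Γ_0, Γ_0)`. -/
def FfinGammaGamma (X : Type u) [TopologicalSpace X] : Prop :=
  ∀ S : ℕ → Set (X → ℝ), (∀ n, GammaZero (S n)) →
    ∃ F : ℕ → Set (X → ℝ), (∀ n, F n ⊆ S n ∧ (F n).Finite) ∧
      ∀ ε : ℝ, 0 < ε → ∀ K : Set X, K.Finite →
        ∃ n' : ℕ, ∀ n : ℕ, n' < n → ∀ x ∈ K, ∃ h ∈ F n, |h x| < ε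

/-- `C_p(X)` satisfies `F_fin(𝒮, Γ_0)`. -/
def FfinSGamma (X : Type u) [TopologicalSpace X] : Prop :=
  ∀ S : ℕ → Set (X → ℝ), (∀ n, SeqDenseCp (S n)) →
    ∃ F : ℕ → Set (X → ℝ), (∀ n, F n ⊆ S n ∧ (F n).Finite) ∧
      ∀ ε : ℝ, 0 < ε → ∀ K : Set X, K.Finite →
        ∃ n' : ℕ, ∀ n : ℕ, n' < n → ∀ x ∈ K, ∃ h ∈ F n, |h x| < ε

/-- `iw(X) = ℵ₀`: there is a continuous bijection from `X` onto a second-countable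
Tychonoff space. -/
def IWCountable (X : Type u) [TopologicalSpace X] : Prop :=
  ∃ (Y : Type u) (tY : TopologicalSpace Y),
    @SecondCountableTopology Y tY ∧ @CompletelyRegularSpace Y tY ∧ @T2Space Y tY ∧
    ∃ f : X → Y, @Continuous X Y _ tY f ∧ Function.Bijective f

/-- The Velichko property `X ⊨ V`: there is a continuous bijection onto a separable
metrizable space sending every cozero-set to an `F_σ`-set. -/
def VelichkoProperty (X : Type u) [TopologicalSpace X] : Prop :=
  ∃ (Y : Type u) (tY : TopologicalSpace Y),
    @TopologicalSpace.MetrizableSpace Y tY ∧ @TopologicalSpace.SeparableSpace Y tY ∧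
    ∃ f : X → Y, @Continuous X Y _ tY f ∧ Function.Bijective f ∧
      ∀ U : Set X, IsCozeroSet U →
        ∃ Z : ℕ → Set Y, (∀ n, @IsClosed Y tY (Z n)) ∧ f '' U = ⋃ n, Z n

section ZeroSets

variable {X : Type u} [TopologicalSpace X]

theorem isZeroSet_setOf_le {f g : X → ℝ} (hf : Continuous f) (hg : Continuous g) :
    IsZeroSet {x | f x ≤ g x} := by
  refine ⟨fun x => max (f x - g x) 0, by fun_prop, ?_⟩
  ext x
  simp

theorem isCozeroSet_setOf_lt {f g : X → ℝ} (hf : Continuous f) (hg : Continuous g) :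
    IsCozeroSet {x | f x < g x} := by
  have h : {x | f x < g x}ᶜ = {x | g x ≤ f x} := by
    ext x
    simp
  rw [IsCozeroSet, h]
  exact isZeroSet_setOf_le hg hf

/-- A continuous function can be modified off a zero-set `Z` so as to be constantly `1` off a
given cozero-set containing `Z`. -/
theorem exists_continuous_eqOn_zeroSet_eq_one {Z U : Set X} (hZ : IsZeroSet Z)
    (hU : IsCozeroSet U) (hZU : Z ⊆ U) {f : X → ℝ} (hf : Continuous f) :
    ∃ g : X → ℝ, Continuous g ∧ EqOn g f Z ∧ ∀ x ∉ U, g x = 1 := by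
  obtain ⟨a, ha, rfl⟩ := hZ
  obtain ⟨b, hb, hbU⟩ := hU
  have hmem (x : X) : x ∉ U ↔ b x = 0 := by
    rw [← mem_compl_iff, hbU]
    simp
  have hpos (x : X) : |a x| + |b x| ≠ 0 := by
    intro h
    have ha0 : a x = 0 := abs_eq_zero.mp (by linarith [abs_nonneg (a x), abs_nonneg (b x)])
    have hb0 : b x = 0 := abs_eq_zero.mp (by linarith [abs_nonneg (a x), abs_nonneg (b x)])
    exact (hmem x).mpr hb0 (hZU ha0)
  have hφ : Continuous fun x => |b x| / (|a x| + |b x|) :=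
    hb.abs.div (ha.abs.add hb.abs) hpos
  refine ⟨fun x => f x * (|b x| / (|a x| + |b x|)) + (1 - |b x| / (|a x| + |b x|)),
    (hf.mul hφ).add (continuous_const.sub hφ), fun x hx => ?_, fun x hx => ?_⟩
  · have hax : a x = 0 := hx
    have hbx : |b x| ≠ 0 := by simpa [hax] using hpos x
    simp [hax, div_self hbx]
  · simp [(hmem x).mp hx]

end ZeroSets

section Covers

variable {X : Type u}

theorem infinite_of_not_hasFinSubcover {𝒰 : Set (Set X)} (hcov : ⋃₀ 𝒰 = univ)
    (h : ¬ HasFinSubcover 𝒰) : 𝒰.Infinite :=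
  fun hfin => h ⟨𝒰, Subset.rfl, hfin, hcov⟩

theorem univ_notMem_of_not_hasFinSubcover {𝒰 : Set (Set X)} (h : ¬ HasFinSubcover 𝒰) :
    univ ∉ 𝒰 :=
  fun hmem => h ⟨{univ}, singleton_subset_iff.mpr hmem, finite_singleton _, sUnion_singleton _⟩

/-- Refining a family indexed by `s` preserves the lack of a finite subcover. -/
theorem not_hasFinSubcover_image_of_subset {ι : Type*} {s : Set ι} {u v : ι → Set X}
    (huv : ∀ i ∈ s, u i ⊆ v i) (hv : ¬ HasFinSubcover (v '' s)) :
    ¬ HasFinSubcover (u '' s) := by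
  rintro ⟨𝓕, h𝓕, hfin, hcov⟩
  obtain ⟨t, hts, htfin, rfl⟩ :=
      exists_subset_image_finite_and (p := (· = 𝓕)).mp ⟨𝓕, h𝓕, hfin, rfl⟩
  refine hv ⟨v '' t, image_mono hts, htfin.image v, eq_univ_of_univ_subset ?_⟩
  rw [← hcov, sUnion_image, sUnion_image]
  exact biUnion_mono Subset.rfl fun i hi => huv i (hts hi)

/-- A family of sets indexed by an infinite set, without finite subcovers, such that each point
is outside only finitely many indexed members, is a `γ`-cover. -/
theorem isGammaCoverSets_image {ι : Type*} {s : Set ι} {u : ι → Set X} (hs : s.Infinite)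
    (hfin : ∀ x, {i ∈ s | x ∉ u i}.Finite) (hu : ¬ HasFinSubcover (u '' s)) :
    IsGammaCoverSets (u '' s) := by
  have hcov : ⋃₀ (u '' s) = univ := by
    refine eq_univ_of_forall fun x => ?_
    obtain ⟨i, hi, hxi⟩ := (hs.sdiff (hfin x)).nonempty
    exact ⟨u i, mem_image_of_mem u hi, by_contra fun hx => hxi ⟨hi, hx⟩⟩
  refine ⟨univ_notMem_of_not_hasFinSubcover hu, infinite_of_not_hasFinSubcover hcov hu, hcov,
    fun x => ((hfin x).image u).subset ?_⟩
  rintro _ ⟨⟨i, hi, rfl⟩, hx⟩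
  exact ⟨i, ⟨hi, hx⟩, rfl⟩

/-- In a sequence of proper subsets capturing every finite set, every finite set is captured
arbitrarily late. -/
theorem exists_ge_subset_of_forall_finite {V : ℕ → Set X} (hne : ∀ n, V n ≠ univ)
    (hV : ∀ K : Set X, K.Finite → ∃ n, K ⊆ V n) {K : Set X} (hK : K.Finite) (M : ℕ) :
    ∃ n ≥ M, K ⊆ V n := by
  choose p hp using fun n => (ne_univ_iff_exists_notMem (V n)).mp (hne n)
  obtain ⟨n, hn⟩ := hV (K ∪ p '' Iio M) (hK.union ((finite_Iio M).image p))
  refine ⟨n, not_lt.mp fun hlt => hp n (hn (Or.inr ⟨n, hlt, rfl⟩)), subset_union_left.trans hn⟩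

end Covers

section FunctionSpaces

variable {X : Type u} [TopologicalSpace X]

theorem GammaZero.finite_setOf_le_abs {A : Set (X → ℝ)} (hA : GammaZero A) {c : ℝ} (hc : 0 < c)
    (x : X) : {h ∈ A | c ≤ |h x|}.Finite := by
  have hU : {g : X → ℝ | |g x| < c} ∈ 𝓝 (0 : X → ℝ) :=
    (isOpen_lt (continuous_apply x).abs continuous_const).mem_nhds (by simpa using hc)
  refine (hA.2.2.2.2 _ hU).subset ?_
  rintro h ⟨hh, hx⟩
  exact ⟨hh, not_lt.mpr hx⟩

theorem GammaZero.isGammaFCover {A : Set (X → ℝ)} (hA : GammaZero A) {r s : ℝ} (hr : 0 < r)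
    (hrs : r < s) (hno : ¬ HasFinSubcover ((fun h : X → ℝ => {x | |h x| < s}) '' A)) :
    IsGammaFCover ((fun h : X → ℝ => {x | |h x| < s}) '' A) := by
  set u : (X → ℝ) → Set X := fun h => {x | |h x| < s}
  have hcont := hA.2.1
  have hγ : IsGammaCoverSets (u '' A) :=
    isGammaCoverSets_image hA.2.2.2.1
      (fun x => (hA.finite_setOf_le_abs (hr.trans hrs) x).subset
        fun h hh => ⟨hh.1, not_lt.mp hh.2⟩) hno
  choose! w hwA hwu using fun U (hU : U ∈ u '' A) => hU
  have hsub : ∀ U ∈ u '' A, {x | |w U x| ≤ r} ⊆ U := fun U hU x hx => by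
    rw [← hwu U hU]
    exact lt_of_le_of_lt hx hrs
  refine ⟨⟨?_, hγ⟩, ?_, fun U => {x | |w U x| ≤ r},
    fun U hU => ⟨isZeroSet_setOf_le (hcont _ (hwA U hU)).abs continuous_const, hsub U hU⟩, ?_⟩
  · rintro _ ⟨h, hh, rfl⟩
    exact isOpen_lt (hcont h hh).abs continuous_const
  · rintro _ ⟨h, hh, rfl⟩
    exact isCozeroSet_setOf_lt (hcont h hh).abs continuous_const
  · refine isGammaCoverSets_image hγ.2.1 (fun x => ?_)
      (not_hasFinSubcover_image_of_subset (v := id) hsub (by simpa using hno))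
    refine ((hA.finite_setOf_le_abs hr x).image u).subset ?_
    rintro U ⟨hU, hx⟩
    exact ⟨w U, ⟨hwA U hU, (not_le.mp hx).le⟩, hwu U hU⟩

theorem IsGammaFCover.seqDenseCp {𝒰 : Set (Set X)} (h𝒰 : IsGammaFCover 𝒰) :
    SeqDenseCp {f : X → ℝ | Continuous f ∧ ∃ U ∈ 𝒰, ∀ x ∉ U, f x = 1} := by
  obtain ⟨-, hcoz, F, hF, -, hinf, -, hfin⟩ := h𝒰
  refine ⟨fun f hf => hf.1, fun f hf => ?_⟩
  have hZ (k : ℕ) : ∃ U ∈ 𝒰, F U = (hinf.natEmbedding _ k : Set X) :=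
    (hinf.natEmbedding _ k).2
  choose U hU hFU using hZ
  choose g hgc hgf hg1 using fun k =>
    exists_continuous_eqOn_zeroSet_eq_one (hF _ (hU k)).1 (hcoz _ (hU k)) (hF _ (hU k)).2 hf
  refine ⟨g, fun k => ⟨hgc k, U k, hU k, hg1 k⟩, tendsto_pi_nhds.mpr fun x => ?_⟩
  have hx : {k | x ∉ F (U k)}.Finite := by
    have hinj : Function.Injective fun k => (hinf.natEmbedding _ k : Set X) :=
      Subtype.val_injective.comp (hinf.natEmbedding _).injective
    refine ((hfin x).preimage hinj.injOn).subset fun k hk => ⟨(hinf.natEmbedding _ k).2, ?_⟩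
    simp only [← hFU k]
    exact hk
  refine tendsto_const_nhds.congr' ?_
  rw [← Nat.cofinite_eq_atTop]
  filter_upwards [hx.compl_mem_cofinite] with k hk
  exact (hgf k (not_not.mp hk)).symm

/-- The range of a sequence of nonzero continuous functions converging to zero is in `Γ_0`. -/
theorem gammaZero_range {g : ℕ → X → ℝ} (hc : ∀ n, Continuous (g n)) (h0 : ∀ n, g n ≠ 0)
    (hg : Tendsto g atTop (𝓝 0)) : GammaZero (range g) := by
  refine ⟨countable_range g, forall_mem_range.mpr hc, fun ⟨n, hn⟩ => h0 n hn, fun hfin => ?_,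
    fun U hU => ?_⟩
  · obtain ⟨n, hn⟩ := hfin.isClosed.mem_of_tendsto hg (Eventually.of_forall mem_range_self)
    exact h0 n hn
  · have hev : {n | g n ∉ U}.Finite := by
      rw [← Nat.cofinite_eq_atTop] at hg
      exact hg hU
    refine (hev.image g).subset ?_
    rintro _ ⟨⟨n, rfl⟩, hn⟩
    exact ⟨n, hn, rfl⟩

/-- Under `F_fin(Γ_0, Ω_0)`, sequences of sets that each contain a sequence converging to `d`
have a finite selection approximating `d`. -/
theorem FfinGammaOmega.exists_finite_approx (hX : FfinGammaOmega X) {d : X → ℝ}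
    (hd : Continuous d) {S : ℕ → Set (X → ℝ)} (hSc : ∀ n, ∀ f ∈ S n, Continuous f)
    (hS : ∀ n, ∃ g : ℕ → X → ℝ, (∀ k, g k ∈ S n) ∧ Tendsto g atTop (𝓝 d)) :
    ∃ F : ℕ → Set (X → ℝ), (∀ n, F n ⊆ S n ∧ (F n).Finite) ∧
      ∀ ε : ℝ, 0 < ε → ∀ K : Set X, K.Finite →
        ∃ n : ℕ, ∀ x ∈ K, ∃ h ∈ F n, |d x - h x| < ε := by
  by_cases htriv : ∃ n, d ∈ S n
  · obtain ⟨n, hn⟩ := htriv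
    refine ⟨fun m => S m ∩ {d}, fun m => ⟨inter_subset_left, (finite_singleton d).inter_of_right _⟩,
      fun ε hε K _ => ⟨n, fun x _ => ⟨d, ⟨hn, rfl⟩, by simpa using hε⟩⟩⟩
  push Not at htriv
  choose g hgS hgd using hS
  obtain ⟨F, hF, hFK⟩ := hX (fun n => range fun k => g n k - d) fun n =>
    gammaZero_range (fun k => (hSc n _ (hgS n k)).sub hd)
      (fun k hk => htriv n (sub_eq_zero.mp hk ▸ hgS n k))
      (by simpa using (hgd n).sub_const d)
  refine ⟨fun n => (· + d) '' F n, fun n => ⟨?_, (hF n).2.image _⟩, fun ε hε K hK => ?_⟩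
  · rintro _ ⟨h, hh, rfl⟩
    obtain ⟨k, rfl⟩ := (hF n).1 hh
    simpa using hgS n k
  · obtain ⟨n, hn⟩ := hFK ε hε K hK
    refine ⟨n, fun x hx => ?_⟩
    obtain ⟨h, hh, hhx⟩ := hn x hx
    exact ⟨h + d, ⟨h, hh, rfl⟩, by simpa using hhx⟩

/-- If `iw(X) = ℵ₀` then `C_p(X)` has a dense sequence. -/
theorem IWCountable.exists_dense_seq (hiw : IWCountable X) :
    ∃ d : ℕ → X → ℝ, (∀ j, Continuous (d j)) ∧ ∀ f : X → ℝ, ∀ ε : ℝ, 0 < ε →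
      ∀ K : Set X, K.Finite → ∃ j, ∀ x ∈ K, |f x - d j x| < ε := by
  obtain ⟨Y, tY, hsc, hcr, ht2, p, hp, hbij⟩ := hiw
  let _ : MetricSpace Y := TopologicalSpace.metrizableSpaceMetric Y
  obtain ⟨e, he⟩ := Metric.PiNatEmbed.exists_embedding_to_hilbert_cube (X := Y)
  have hinj : Function.Injective (e ∘ p) := he.injective.comp hbij.injective
  let D := TopologicalSpace.denseSeq C(ℕ → unitInterval, ℝ)
  refine ⟨fun j => D j ∘ e ∘ p, fun j => (D j).continuous.comp (he.continuous.comp hp),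
    fun f ε hε K hK => ?_⟩
  have hfin : ((e ∘ p) '' K).Finite := hK.image _
  have : Finite ((e ∘ p) '' K) := hfin
  obtain ⟨G, hG⟩ := ContinuousMap.exists_restrict_eq hfin.isClosed
    (⟨fun q => Function.extend (e ∘ p) f 0 q, continuous_of_discreteTopology⟩ :
      C((e ∘ p) '' K, ℝ))
  have hGf : ∀ x ∈ K, G (e (p x)) = f x := fun x hx => by
    have h := congrArg (fun φ => φ ⟨e (p x), mem_image_of_mem (e ∘ p) hx⟩) hG
    simpa using h.trans (hinj.extend_apply f 0 x)
  have hopen : IsOpen {H : C(ℕ → unitInterval, ℝ) | ∀ x ∈ K, |f x - H (e (p x))| < ε} := by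
    simp only [ofPred_forall]
    exact hK.isOpen_biInter fun x _ =>
      isOpen_lt (continuous_const.sub (continuous_eval_const _)).abs continuous_const
  obtain ⟨j, hj⟩ := (TopologicalSpace.denseRange_denseSeq C(ℕ → unitInterval, ℝ)).exists_mem_open
    hopen ⟨G, fun x hx => by simpa [hGf x hx] using hε⟩
  exact ⟨j, hj⟩

end FunctionSpaces

section Implications

variable {X : Type u} [TopologicalSpace X]

theorem FfinSD.ffinSOmega (hX : FfinSD X) : FfinSOmega X := fun S hS => by
  obtain ⟨F, hF, hFK⟩ := hX S hS
  exact ⟨F, hF, fun ε hε K hK => by simpa using hFK 0 continuous_const ε hε K hK⟩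

theorem FfinSOmega.ufinGammaFOmega (hX : FfinSOmega X) : UfinGammaFOmega X := by
  intro 𝒰 h𝒰 hno
  obtain ⟨F, hF, hFK⟩ := hX _ fun n => (h𝒰 n).seqDenseCp
  have hF' : ∀ n, ∀ h ∈ F n, ∃ U ∈ 𝒰 n, ∀ x ∉ U, h x = 1 := fun n h hh => ((hF n).1 hh).2
  choose! U hU hU1 using hF'
  have hsub (n : ℕ) : U n '' F n ⊆ 𝒰 n := image_subset_iff.mpr (hU n)
  have hω : ∀ K : Set X, K.Finite → ∃ n, K ⊆ ⋃₀ (U n '' F n) := fun K hK => by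
    obtain ⟨n, hn⟩ := hFK 1 one_pos K hK
    refine ⟨n, fun x hx => ?_⟩
    obtain ⟨h, hh, hhx⟩ := hn x hx
    refine ⟨U n h, mem_image_of_mem _ hh, by_contra fun hxU => ?_⟩
    simp [hU1 n h hh x hxU] at hhx
  refine ⟨fun n => U n '' F n, fun n => ⟨hsub n, (hF n).2.image _⟩, ?_, ?_, ?_, ?_⟩
  · rintro _ ⟨n, rfl⟩
    exact isOpen_sUnion fun V hV => (h𝒰 n).1.1 V (hsub n hV)
  · rintro ⟨n, hn⟩
    exact hno n ⟨_, hsub n, (hF n).2.image _, hn⟩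
  · refine eq_univ_of_forall fun x => ?_
    obtain ⟨n, hn⟩ := hω {x} (finite_singleton x)
    exact ⟨_, mem_range_self n, hn rfl⟩
  · intro K hK
    obtain ⟨n, hn⟩ := hω K hK
    exact ⟨_, mem_range_self n, hn⟩

theorem UfinGammaFOmega.ffinGammaOmega (hX : UfinGammaFOmega X) : FfinGammaOmega X := by
  intro S hS
  set u : ℕ → (X → ℝ) → Set X := fun n h => {x | |h x| < 1 / ((n : ℝ) + 1)}
  have hlt (n : ℕ) : (1 : ℝ) / ((n : ℝ) + 2) < 1 / ((n : ℝ) + 1) :=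
    one_div_lt_one_div_of_lt (by positivity) (by linarith)
  -- It suffices to capture each finite set by the sets `u n h` for arbitrarily large `n`.
  suffices H : ∃ F : ℕ → Set (X → ℝ), (∀ n, F n ⊆ S n ∧ (F n).Finite) ∧
      ∀ K : Set X, K.Finite → ∀ M, ∃ n ≥ M, K ⊆ ⋃ h ∈ F n, u n h by
    obtain ⟨F, hF, hFK⟩ := H
    refine ⟨F, hF, fun ε hε K hK => ?_⟩
    obtain ⟨M, hM⟩ := exists_nat_one_div_lt hε
    obtain ⟨n, hn, hKn⟩ := hFK K hK M
    refine ⟨n, fun x hx => ?_⟩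
    obtain ⟨h, hh, hhx⟩ := mem_iUnion₂.mp (hKn hx)
    exact ⟨h, hh, (lt_of_lt_of_le hhx (one_div_le_one_div_of_le (by positivity)
      (by exact_mod_cast Nat.succ_le_succ hn))).trans hM⟩
  by_cases hfreq : ∀ M, ∃ n ≥ M, HasFinSubcover (u n '' S n)
  · have hsel (n : ℕ) : ∃ F ⊆ S n, F.Finite ∧
        (HasFinSubcover (u n '' S n) → ⋃ h ∈ F, u n h = univ) := by
      by_cases h : HasFinSubcover (u n '' S n)
      · obtain ⟨𝓕, h𝓕, hfin, hcov⟩ := h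
        obtain ⟨F, hFS, hFfin, rfl⟩ :=
          exists_subset_image_finite_and (p := (· = 𝓕)).mp ⟨𝓕, h𝓕, hfin, rfl⟩
        exact ⟨F, hFS, hFfin, fun _ => by rwa [← sUnion_image]⟩
      · exact ⟨∅, empty_subset _, finite_empty, fun h' => absurd h' h⟩
    choose F hFS hFfin hFcov using hsel
    refine ⟨F, fun n => ⟨hFS n, hFfin n⟩, fun K _ M => ?_⟩
    obtain ⟨n, hn, hcov⟩ := hfreq M
    exact ⟨n, hn, (hFcov n hcov).symm ▸ subset_univ K⟩
  · push Not at hfreq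
    obtain ⟨N, hN⟩ := hfreq
    have hno (n : ℕ) : ¬ HasFinSubcover (u (N + n) '' S (N + n)) := hN _ (Nat.le_add_right N n)
    obtain ⟨𝓕, h𝓕, -, huniv, -, hω⟩ := hX (fun n => u (N + n) '' S (N + n))
      (fun n => (hS _).isGammaFCover (by positivity) (hlt _) (hno n)) hno
    have hsel (n : ℕ) : ∃ F ⊆ S n, F.Finite ∧ (N ≤ n → ⋃ h ∈ F, u n h = ⋃₀ 𝓕 (n - N)) := by
      by_cases hn : N ≤ n
      · have h := h𝓕 (n - N)
        rw [Nat.add_sub_cancel' hn] at h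
        obtain ⟨F, hFS, hFfin, hF⟩ :=
          exists_subset_image_finite_and (p := (· = 𝓕 (n - N))).mp ⟨_, h.1, h.2, rfl⟩
        exact ⟨F, hFS, hFfin, fun _ => by rw [← hF, sUnion_image]⟩
      · exact ⟨∅, empty_subset _, finite_empty, fun h' => absurd h' hn⟩
    choose F hFS hFfin hFcov using hsel
    refine ⟨F, fun n => ⟨hFS n, hFfin n⟩, fun K hK M => ?_⟩
    obtain ⟨n, hn, hKn⟩ := exists_ge_subset_of_forall_finite (V := fun n => ⋃₀ 𝓕 n)
      (fun n h => huniv ⟨n, h⟩) (fun K hK => by simpa using hω K hK) hK M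
    refine ⟨N + n, hn.trans (Nat.le_add_left n N), ?_⟩
    rw [hFcov _ (Nat.le_add_right N n), Nat.add_sub_cancel_left]
    exact hKn

theorem FfinGammaOmega.ffinSD (hX : FfinGammaOmega X) (hiw : IWCountable X) : FfinSD X := by
  intro S hS
  obtain ⟨d, hdc, hd⟩ := hiw.exists_dense_seq
  choose F hF hFK using fun j => hX.exists_finite_approx (hdc j)
    (S := fun i => S (Nat.pair j i)) (fun i => (hS _).1) (fun i => (hS _).2 (d j) (hdc j))
  refine ⟨fun n => F n.unpair.1 n.unpair.2, fun n => ?_, fun f _ ε hε K hK => ?_⟩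
  · simpa using hF n.unpair.1 n.unpair.2
  · obtain ⟨j, hj⟩ := hd f (ε / 2) (half_pos hε) K hK
    obtain ⟨i, hi⟩ := hFK j (ε / 2) (half_pos hε) K hK
    refine ⟨Nat.pair j i, fun x hx => ?_⟩
    obtain ⟨h, hh, hhx⟩ := hi x hx
    refine ⟨h, by simpa using hh, ?_⟩
    calc |f x - h x| ≤ |f x - d j x| + |d j x - h x| := abs_sub_le _ _ _
      _ < ε := by linarith [hj x hx]

end Implications

/-- Theorem 3.3: for a Tychonoff space `X` with `iw(X) = ℵ₀`, the following are
equivalent: (1) `C_p(X) ⊨ F_fin(𝒮, 𝒟)`; (2) `X ⊨ U_fin(Γ_F, Ω)`;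
(3) `C_p(X) ⊨ F_fin(Γ_0, Ω_0)`; (4) `C_p(X) ⊨ F_fin(𝒮, Ω_0)`. -/
theorem stmt2 (X : Type u) [TopologicalSpace X] [CompletelyRegularSpace X] [T2Space X]
    (hiw : IWCountable X) :
    [FfinSD X, UfinGammaFOmega X, FfinGammaOmega X, FfinSOmega X].TFAE := by
  tfae_have 1 → 4 := FfinSD.ffinSOmega
  tfae_have 4 → 2 := FfinSOmega.ufinGammaFOmega
  tfae_have 2 → 3 := UfinGammaFOmega.ffinGammaOmega
  tfae_have 3 → 1 := fun h => h.ffinSD hiw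
  tfae_finish
end

section
/- For a Tychonoff space X, the following are equivalent: (1) X is Lindelöf and X satisfies U_fin(Γ_F, Ω); (2) X satisfies U_fin(𝒪, Ω). -/
open Set Filter Topology

universe u

/-- Finitely many terms of an increasing sequence of sets lie below a single term. -/
lemma exists_sUnion_subset_of_finite_of_monotone {X : Type u} {V : ℕ → Set X}
    (hV : Monotone V) {𝓕 : Set (Set X)} (hsub : 𝓕 ⊆ range V) (hfin : 𝓕.Finite) :
    ∃ N, ⋃₀ 𝓕 ⊆ V N := by
  rw [← image_univ] at hsub
  obtain ⟨T, -, hT, rfl⟩ := exists_subset_image_finite_and.1 ⟨𝓕, hsub, hfin, rfl⟩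
  obtain ⟨N, hN⟩ := hT.bddAbove
  refine ⟨N, sUnion_subset ?_⟩
  rintro _ ⟨t, ht, rfl⟩
  exact hV (hN ht)

/-- The terms of an increasing exhaustion by proper subsets, taken along any infinite set of
indices, form a γ-cover. -/
lemma isGammaCoverSets_image_of_monotone {X : Type u} {F : ℕ → Set X} (hF : Monotone F)
    (hcov : ∀ x, ∃ k, x ∈ F k) (hne : ∀ k, F k ≠ univ) {T : Set ℕ} (hT : T.Infinite) :
    IsGammaCoverSets (F '' T) := by
  have hmem : ∀ x, ∃ t ∈ T, x ∈ F t := fun x => by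
    obtain ⟨k, hk⟩ := hcov x
    obtain ⟨t, ht, hkt⟩ := hT.exists_gt k
    exact ⟨t, ht, hF hkt.le hk⟩
  refine ⟨?_, ?_, ?_, fun x => ?_⟩
  · rintro ⟨k, -, hk⟩
    exact hne k hk
  · intro hfin
    obtain ⟨N, hN⟩ := exists_sUnion_subset_of_finite_of_monotone hF (image_subset_range F T) hfin
    refine hne N (eq_univ_of_forall fun x => ?_)
    obtain ⟨t, ht, hxt⟩ := hmem x
    exact hN ⟨F t, mem_image_of_mem F ht, hxt⟩
  · refine eq_univ_of_forall fun x => ?_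
    obtain ⟨t, ht, hxt⟩ := hmem x
    exact ⟨F t, mem_image_of_mem F ht, hxt⟩
  · obtain ⟨k, hk⟩ := hcov x
    refine ((finite_Iio k).image F).subset ?_
    rintro _ ⟨⟨t, -, rfl⟩, hxt⟩
    exact ⟨t, lt_of_not_ge fun hkt => hxt (hF hkt hk), rfl⟩

/-- Increasing cozero-sets and zero-sets, the latter inside the former, give a
γ_F-shrinkable γ-cover. -/
lemma isGammaFCover_range_of_monotone {X : Type u} [TopologicalSpace X] {V F : ℕ → Set X}
    (hV : Monotone V) (hF : Monotone F) (hFV : ∀ k, F k ⊆ V k) (hcov : ∀ x, ∃ k, x ∈ F k)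
    (hne : ∀ k, V k ≠ univ) (hVo : ∀ k, IsOpen (V k)) (hVc : ∀ k, IsCozeroSet (V k))
    (hFz : ∀ k, IsZeroSet (F k)) : IsGammaFCover (range V) := by
  have hVγ : IsGammaCoverSets (range V) := by
    rw [← image_univ]
    exact isGammaCoverSets_image_of_monotone hV
      (fun x => (hcov x).imp fun k hk => hFV k hk) hne infinite_univ
  have hκ : ∀ U ∈ range V, V (Function.invFun V U) = U := fun U hU => Function.invFun_eq hU
  refine ⟨⟨by rintro _ ⟨k, rfl⟩; exact hVo k, hVγ⟩, by rintro _ ⟨k, rfl⟩; exact hVc k,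
    F ∘ Function.invFun V, fun U hU => ⟨hFz _, (hFV _).trans (hκ U hU).subset⟩, ?_⟩
  rw [image_comp]
  refine isGammaCoverSets_image_of_monotone hF hcov
    (fun k hk => hne k (univ_subset_iff.1 (hk ▸ hFV k))) (hVγ.2.1.image fun U hU W hW h => ?_)
  rw [← hκ U hU, ← hκ W hW, h]

/-- In a Lindelöf completely regular space every open cover has a sequence of members with
subordinate cozero-sets that cover the space. -/
lemma exists_seq_continuous_subordinate {X : Type u} [TopologicalSpace X]
    [CompletelyRegularSpace X] [LindelofSpace X] [Nonempty X] {𝒰 : Set (Set X)}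
    (hopen : ∀ U ∈ 𝒰, IsOpen U) (hcov : ⋃₀ 𝒰 = univ) :
    ∃ (U : ℕ → Set X) (g : ℕ → X → ℝ), (∀ k, U k ∈ 𝒰) ∧ (∀ k, Continuous (g k)) ∧
      (∀ k x, 0 ≤ g k x) ∧ (∀ k x, 0 < g k x → x ∈ U k) ∧ ∀ x, ∃ k, 0 < g k x := by
  have hloc : ∀ x : X, ∃ (U : Set X) (g : X → ℝ), U ∈ 𝒰 ∧ Continuous g ∧ (∀ y, 0 ≤ g y) ∧
      (∀ y, 0 < g y → y ∈ U) ∧ 0 < g x := fun x => by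
    obtain ⟨U, hU, hxU⟩ : x ∈ ⋃₀ 𝒰 := hcov ▸ mem_univ x
    obtain ⟨f, hf, hfx, hfU⟩ := CompletelyRegularSpace.completely_regular x Uᶜ
      (hopen U hU).isClosed_compl (not_not_intro hxU)
    refine ⟨U, fun y => 1 - (f y : ℝ), hU, by fun_prop,
      fun y => sub_nonneg.2 (f y).2.2, fun y hy => ?_, by simp [hfx]⟩
    by_contra hyU
    simp [hfU hyU] at hy
  choose U g hU hg hg0 hgU hgx using hloc
  obtain ⟨t, htc, ht⟩ := countable_cover_nhds fun x =>
    (isOpen_lt continuous_const (hg x)).mem_nhds (hgx x)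
  have hmem : ∀ x, ∃ y ∈ t, 0 < g y x := fun x => by
    simpa using ht.symm.subset (mem_univ x)
  obtain ⟨y₀, hy₀, -⟩ := hmem (Classical.arbitrary X)
  obtain ⟨e, rfl⟩ := htc.exists_eq_range ⟨y₀, hy₀⟩
  refine ⟨U ∘ e, g ∘ e, fun k => hU _, fun k => hg _, fun k => hg0 _, fun k => hgU _,
    fun x => ?_⟩
  obtain ⟨_, ⟨k, rfl⟩, hk⟩ := hmem x
  exact ⟨k, hk⟩

lemma IsCozeroSet.isOpen {X : Type u} [TopologicalSpace X] {U : Set X}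
    (hU : IsCozeroSet U) : IsOpen U := by
  obtain ⟨f, hf, hfU⟩ := hU
  rw [← isClosed_compl_iff, hfU]
  exact isClosed_singleton.preimage hf

lemma isCozeroSet_setOf_pos {X : Type u} [TopologicalSpace X] {h : X → ℝ}
    (hc : Continuous h) : IsCozeroSet {x | 0 < h x} :=
  ⟨fun x => max (h x) 0, by fun_prop, by ext x; simp⟩

lemma isZeroSet_setOf_le_s3 {X : Type u} [TopologicalSpace X] {h : X → ℝ}
    (hc : Continuous h) (a : ℝ) : IsZeroSet {x | a ≤ h x} :=
  ⟨fun x => max (a - h x) 0, by fun_prop, by ext x; simp⟩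

/-- In a Lindelöf completely regular space, an open cover without finite subcover is refined,
up to finite unions, by a γ_F-shrinkable γ-cover without finite subcover. -/
lemma exists_gammaFCover_of_openCover {X : Type u} [TopologicalSpace X]
    [CompletelyRegularSpace X] [LindelofSpace X] [Nonempty X] {𝒰 : Set (Set X)}
    (hopen : ∀ U ∈ 𝒰, IsOpen U) (hcov : ⋃₀ 𝒰 = univ) (hfin : ¬ HasFinSubcover 𝒰) :
    ∃ 𝒱 : Set (Set X), IsGammaFCover 𝒱 ∧ ¬ HasFinSubcover 𝒱 ∧
      ∀ 𝓖 ⊆ 𝒱, 𝓖.Finite → ∃ 𝓕 ⊆ 𝒰, 𝓕.Finite ∧ ⋃₀ 𝓖 ⊆ ⋃₀ 𝓕 := by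
  obtain ⟨U, g, hU, hg, hg0, hgU, hgx⟩ := exists_seq_continuous_subordinate hopen hcov
  set h : ℕ → X → ℝ := fun k x => ∑ i ∈ Finset.range (k + 1), g i x with hh
  have hc : ∀ k, Continuous (h k) := fun k => continuous_finsetSum _ fun i _ => hg i
  have hmono : ∀ x, Monotone fun k => h k x := fun x k l hkl =>
    Finset.sum_le_sum_of_subset_of_nonneg (Finset.range_mono (by omega))
      fun i _ _ => hg0 i x
  have hV : Monotone fun k => {x | 0 < h k x} :=
    fun k l hkl x hx => lt_of_lt_of_le hx (hmono x hkl)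
  have hsub : ∀ k, {x | 0 < h k x} ⊆ ⋃₀ (U '' Iic k) := fun k x hx => by
    obtain ⟨i, hi, hpos⟩ := Finset.exists_lt_of_sum_lt
      (f := fun _ => (0 : ℝ)) (by simpa [hh] using hx)
    exact ⟨U i, ⟨i, Nat.lt_succ_iff.1 (Finset.mem_range.1 hi), rfl⟩, hgU i x hpos⟩
  have himg : ∀ k, U '' Iic k ⊆ 𝒰 := fun k => by
    rintro _ ⟨i, -, rfl⟩
    exact hU i
  have hne : ∀ k, {x | 0 < h k x} ≠ univ := fun k hk =>
    hfin ⟨U '' Iic k, himg k, (finite_Iic k).image U, univ_subset_iff.1 (hk ▸ hsub k)⟩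
  refine ⟨range fun k => {x | 0 < h k x}, isGammaFCover_range_of_monotone
    (F := fun k => {x | 1 / ((k : ℝ) + 1) ≤ h k x}) hV
    (fun k l hkl x hx => (Nat.one_div_le_one_div hkl).trans (le_trans hx (hmono x hkl)))
    (fun k x (hx : _ ≤ h k x) => Nat.one_div_pos_of_nat.trans_le hx) (fun x => ?_) hne
    (fun k => (isCozeroSet_setOf_pos (hc k)).isOpen)
    (fun k => isCozeroSet_setOf_pos (hc k)) (fun k => isZeroSet_setOf_le_s3 (hc k) _), ?_, ?_⟩
  · obtain ⟨i, hi⟩ := hgx x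
    obtain ⟨n, hn⟩ := exists_nat_one_div_lt hi
    refine ⟨max n i, ?_⟩
    calc 1 / (((max n i : ℕ) : ℝ) + 1) ≤ 1 / ((n : ℝ) + 1) :=
          Nat.one_div_le_one_div (le_max_left n i)
      _ ≤ g i x := hn.le
      _ ≤ h (max n i) x := Finset.single_le_sum (f := fun j => g j x) (fun j _ => hg0 j x)
          (Finset.mem_range.2 (Nat.lt_succ_iff.2 (le_max_right n i)))
  · rintro ⟨𝓖, h𝓖, h𝓖fin, h𝓖cov⟩
    obtain ⟨N, hN⟩ := exists_sUnion_subset_of_finite_of_monotone hV h𝓖 h𝓖fin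
    exact hne N (univ_subset_iff.1 (h𝓖cov ▸ hN))
  · intro 𝓖 h𝓖 h𝓖fin
    obtain ⟨N, hN⟩ := exists_sUnion_subset_of_finite_of_monotone hV h𝓖 h𝓖fin
    exact ⟨U '' Iic N, himg N, (finite_Iic N).image U, hN.trans (hsub N)⟩

lemma UfinOOmega.lindelofSpace {X : Type u} [TopologicalSpace X] (hX : UfinOOmega X) :
    LindelofSpace X := by
  refine ⟨isLindelof_of_countable_subcover fun {ι} U hopen hcov => ?_⟩
  have hcov' : ⋃₀ range U = univ := by rw [sUnion_range]; exact univ_subset_iff.1 hcov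
  suffices ∃ 𝓒 ⊆ range U, 𝓒.Countable ∧ ⋃₀ 𝓒 = univ by
    obtain ⟨𝓒, hsub, hcount, h𝓒⟩ := this
    choose e he using fun A : 𝓒 => hsub A.2
    have := hcount.to_subtype
    refine ⟨range e, countable_range e, ?_⟩
    rw [← h𝓒, biUnion_range, sUnion_eq_iUnion]
    exact iUnion_mono fun A => (he A).symm.subset
  by_cases hfin : HasFinSubcover (range U)
  · obtain ⟨𝓕, hsub, h𝓕, huniv⟩ := hfin
    exact ⟨𝓕, hsub, h𝓕.countable, huniv⟩
  · obtain ⟨𝓕, h𝓕, -, -, huniv, -⟩ := hX (fun _ => range U)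
      (fun _ => ⟨by rintro _ ⟨i, rfl⟩; exact hopen i, hcov'⟩) fun _ => hfin
    refine ⟨⋃ n, 𝓕 n, iUnion_subset fun n => (h𝓕 n).1,
      countable_iUnion fun n => (h𝓕 n).2.countable, ?_⟩
    rw [sUnion_iUnion, ← sUnion_range, huniv]

lemma UfinOOmega.ufinGammaFOmega {X : Type u} [TopologicalSpace X] (hX : UfinOOmega X) :
    UfinGammaFOmega X :=
  fun 𝒰 h𝒰 hfin => hX 𝒰 (fun n => ⟨(h𝒰 n).1.1, (h𝒰 n).1.2.2.2.1⟩) hfin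

lemma UfinGammaFOmega.ufinOOmega {X : Type u} [TopologicalSpace X]
    [CompletelyRegularSpace X] [LindelofSpace X] (hX : UfinGammaFOmega X) :
    UfinOOmega X := by
  intro 𝒰 h𝒰 hfin
  have hne : Nonempty X := by
    by_contra hempty
    rw [not_nonempty_iff] at hempty
    exact hfin 0 ⟨∅, empty_subset _, finite_empty, Subsingleton.elim _ _⟩
  choose 𝒱 h𝒱 h𝒱fin href using fun n =>
    exists_gammaFCover_of_openCover (h𝒰 n).1 (h𝒰 n).2 (hfin n)
  obtain ⟨𝓖, h𝓖, -, -, -, hω⟩ := hX 𝒱 h𝒱 h𝒱fin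
  choose 𝓕 h𝓕 h𝓕fin h𝓖𝓕 using fun n => href n (𝓖 n) (h𝓖 n).1 (h𝓖 n).2
  have hω' : ∀ K : Set X, K.Finite → ∃ U ∈ range fun n => ⋃₀ 𝓕 n, K ⊆ U := by
    intro K hK
    obtain ⟨_, ⟨n, rfl⟩, hn⟩ := hω K hK
    exact ⟨_, ⟨n, rfl⟩, hn.trans (h𝓖𝓕 n)⟩
  refine ⟨𝓕, fun n => ⟨h𝓕 n, h𝓕fin n⟩, ?_, ?_, eq_univ_of_forall fun x => ?_, hω'⟩
  · rintro _ ⟨n, rfl⟩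
    exact isOpen_sUnion fun U hU => (h𝒰 n).1 U (h𝓕 n hU)
  · rintro ⟨n, hn⟩
    exact hfin n ⟨𝓕 n, h𝓕 n, h𝓕fin n, hn⟩
  · obtain ⟨U, hU, hxU⟩ := hω' {x} (finite_singleton x)
    exact ⟨U, hU, hxU rfl⟩

/-- Theorem 3.4: for a Tychonoff space `X`, `X` is Lindelöf and satisfies
`U_fin(Γ_F, Ω)` iff `X` satisfies `U_fin(𝒪, Ω)`. -/
theorem stmt3 (X : Type u) [TopologicalSpace X] [CompletelyRegularSpace X] [T2Space X] :
    (LindelofSpace X ∧ UfinGammaFOmega X) ↔ UfinOOmega X := by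
  exact ⟨fun ⟨_, hX⟩ => hX.ufinOOmega, fun hX => ⟨hX.lindelofSpace, hX.ufinGammaFOmega⟩⟩
end

section
/- For a Tychonoff space X, the following are equivalent: (1) C_p(X) satisfies F_fin(Γ_0, Γ_0); (2) X satisfies U_fin(Γ_F, Γ). -/
open Set Filter Topology

universe u

section Helpers

variable {X : Type u}

theorem isGammaCoverSets_of_not_hasFinSubcover {𝒱 : Set (Set X)} (h : ¬ HasFinSubcover 𝒱)
    (hcov : ⋃₀ 𝒱 = univ) (hfin : ∀ x : X, {V ∈ 𝒱 | x ∉ V}.Finite) : IsGammaCoverSets 𝒱 := by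
  refine ⟨fun hu => h ⟨{univ}, by simpa using hu, finite_singleton _, by simp⟩, fun hf => ?_,
    hcov, hfin⟩
  exact h ⟨𝒱, subset_rfl, hf, hcov⟩

theorem HasFinSubcover.exists_finite_index {ι : Type*} {u : ι → Set X}
    (h : HasFinSubcover (range u)) : ∃ M : Set ι, M.Finite ∧ ∀ x, ∃ m ∈ M, x ∈ u m := by
  rw [← image_univ] at h
  obtain ⟨M, -, hM, hcov⟩ := exists_subset_image_finite_and.1 h
  refine ⟨M, hM, fun x => ?_⟩
  obtain ⟨_, ⟨m, hm, rfl⟩, hx⟩ := hcov.symm ▸ mem_univ x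
  exact ⟨m, hm, hx⟩

variable [TopologicalSpace X]

theorem isZeroSet_le {g : X → ℝ} (hg : Continuous g) (c : ℝ) : IsZeroSet {x | g x ≤ c} :=
  ⟨fun x => max (g x - c) 0, by fun_prop, by ext x; simp⟩

theorem isCozeroSet_lt {g : X → ℝ} (hg : Continuous g) (c : ℝ) : IsCozeroSet {x | g x < c} := by
  have h := isZeroSet_le (g := fun x => -g x) (by fun_prop) (-c)
  have e : {x | g x < c}ᶜ = {x | -g x ≤ -c} := by ext x; simp
  rwa [IsCozeroSet, e]

/-- Sublevel sets of a pointwise null sequence form a `γ_F`-shrinkable cover, unless finitely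
many of them already cover the space. -/
theorem isGammaFCover_range_lt {g : ℕ → X → ℝ} (hg : ∀ m, Continuous (g m))
    (hlim : ∀ x, Tendsto (fun m => g m x) atTop (𝓝 0)) {c : ℝ} (hc : 0 < c)
    (h : ¬ HasFinSubcover (range fun m => {x | g m x < c})) :
    IsGammaFCover (range fun m => {x | g m x < c}) := by
  have key : ∀ x, ∀ d > 0, ∃ N, ∀ m ≥ N, g m x < d := fun x d hd =>
    eventually_atTop.1 ((hlim x).eventually (gt_mem_nhds hd))
  have hγ : IsGammaCoverSets (range fun m => {x | g m x < c}) := by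
    refine isGammaCoverSets_of_not_hasFinSubcover h ?_ fun x => ?_
    · refine eq_univ_of_forall fun x => ?_
      obtain ⟨N, hN⟩ := key x c hc
      exact ⟨_, ⟨N, rfl⟩, hN N le_rfl⟩
    · obtain ⟨N, hN⟩ := key x c hc
      refine ((finite_Iio N).image fun m => {x | g m x < c}).subset ?_
      rintro _ ⟨⟨m, rfl⟩, hm⟩
      refine ⟨m, ?_, rfl⟩
      by_contra hmN
      exact hm (hN m (not_lt.1 hmN))
  refine ⟨⟨?_, hγ⟩, ?_, ?_⟩
  · rintro _ ⟨m, rfl⟩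
    exact isOpen_lt (hg m) continuous_const
  · rintro _ ⟨m, rfl⟩
    exact isCozeroSet_lt (hg m) c
  set u : ℕ → Set X := fun m => {x | g m x < c}
  set F : Set X → Set X := fun U => {x | g (Function.invFun u U) x ≤ c / 2}
  have hinv : ∀ U ∈ range u, u (Function.invFun u U) = U := fun U hU => Function.invFun_eq hU
  have hsub : ∀ U ∈ range u, F U ⊆ U := by
    intro U hU x hx
    rw [← hinv U hU]
    exact lt_of_le_of_lt (show g (Function.invFun u U) x ≤ c / 2 from hx) (by linarith)
  refine ⟨F, fun U hU => ⟨isZeroSet_le (hg _) _, hsub U hU⟩, ?_⟩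
  have hsmall : ∀ x, ∃ N, ∀ U, N ≤ Function.invFun u U → x ∈ F U := by
    intro x
    obtain ⟨N, hN⟩ := key x (c / 2) (by linarith)
    exact ⟨N, fun U hU => (hN _ hU).le⟩
  refine isGammaCoverSets_of_not_hasFinSubcover ?_ ?_ fun x => ?_
  · intro hF'
    obtain ⟨𝒢, h𝒢, h𝒢fin, hcov⟩ := exists_subset_image_finite_and.1 hF'
    refine h ⟨𝒢, h𝒢, h𝒢fin, eq_univ_of_forall fun x => ?_⟩
    obtain ⟨_, ⟨U, hU, rfl⟩, hxU⟩ := hcov.symm ▸ mem_univ x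
    exact ⟨U, hU, hsub U (h𝒢 hU) hxU⟩
  · refine eq_univ_of_forall fun x => ?_
    obtain ⟨N, hN⟩ := hsmall x
    have : ((range u) \ (u '' Iio N)).Nonempty :=
      (hγ.2.1.sdiff ((finite_Iio N).image u)).nonempty
    obtain ⟨U, hU, hUN⟩ := this
    refine ⟨F U, mem_image_of_mem F hU, hN U ?_⟩
    by_contra hlt
    exact hUN ⟨_, not_le.1 hlt, hinv U hU⟩
  · obtain ⟨N, hN⟩ := hsmall x
    refine ((finite_Iio N).image fun m => {x | g m x ≤ c / 2}).subset ?_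
    rintro _ ⟨⟨U, hU, rfl⟩, hxU⟩
    refine ⟨Function.invFun u U, ?_, rfl⟩
    by_contra hlt
    exact hxU (hN U (not_lt.1 hlt))

/-- A sequence with infinite range has a subsequence without repetitions. -/
theorem exists_strictMono_injective_comp {α : Type*} {φ : ℕ → α} (h : (range φ).Infinite) :
    ∃ j : ℕ → ℕ, StrictMono j ∧ Function.Injective (φ ∘ j) := by
  obtain ⟨T, hT⟩ := exists_image_eq_and_injOn univ φ
  have hTinf : T.Infinite := fun hf => h (by rw [← image_univ, ← hT.1]; exact hf.image φ)
  classical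
  have : Infinite T := hTinf.to_subtype
  have hmem : ∀ n, Nat.orderEmbeddingOfSet T n ∈ T := fun n =>
    range_subset_iff.1 (Nat.orderEmbeddingOfSet_range T).le n
  exact ⟨Nat.orderEmbeddingOfSet T, (Nat.orderEmbeddingOfSet T).strictMono, fun a b hab =>
    (Nat.orderEmbeddingOfSet T).injective (hT.2 (hmem a) (hmem b) hab)⟩

/-- The indexed form of `F_fin(Γ_0, Γ_0)` for pointwise null sequences of continuous functions. -/
theorem UfinGammaFGamma.exists_finset (hX : UfinGammaFGamma X) {a : ℕ → ℕ → X → ℝ}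
    (ha : ∀ n m, Continuous (a n m)) (hlim : ∀ n x, Tendsto (fun m => a n m x) atTop (𝓝 0)) :
    ∃ M : ℕ → Set ℕ, (∀ n, (M n).Finite) ∧
      ∀ x, ∀ ε > 0, ∀ᶠ n in atTop, ∃ m ∈ M n, |a n m x| < ε := by
  set g : ℕ → ℕ → X → ℝ := fun n m x => ∑ i ∈ Finset.range (n + 1), |a i m x|
  have hgc : ∀ n m, Continuous (g n m) := fun n m => by
    have := ha
    fun_prop
  have hglim : ∀ n x, Tendsto (fun m => g n m x) atTop (𝓝 0) := fun n x => by
    simpa using tendsto_finsetSum (Finset.range (n + 1)) fun i _ => (hlim i x).abs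
  have hle : ∀ {i n}, i ≤ n → ∀ m x, |a i m x| ≤ g n m x := fun {i n} hin m x =>
    Finset.single_le_sum (f := fun i => |a i m x|) (fun _ _ => abs_nonneg _)
      (Finset.mem_range.2 (Nat.lt_succ_of_le hin))
  set u : ℕ → ℕ → Set X := fun n m => {x | g n m x < 1 / ((n : ℝ) + 1)}
  have hmono : ∀ {i n}, i ≤ n → ∀ m x, x ∈ u n m → |a i m x| < 1 / ((i : ℝ) + 1) :=
    fun {i n} hin m x hx => lt_of_le_of_lt (hle hin m x)
      (lt_of_lt_of_le hx (one_div_le_one_div_of_le (by positivity) (by gcongr)))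
  have humono : ∀ {i n}, i ≤ n → ∀ m, u n m ⊆ u i m := fun {i n} hin m x hx =>
    lt_of_le_of_lt (show g i m x ≤ g n m x from Finset.sum_le_sum_of_subset_of_nonneg
        (Finset.range_mono (Nat.succ_le_succ hin)) fun _ _ _ => abs_nonneg _)
      (lt_of_lt_of_le hx (one_div_le_one_div_of_le (by positivity) (by gcongr)))
  suffices H : ∃ M : ℕ → Set ℕ, (∀ n, (M n).Finite) ∧
      ∀ x, ∀ᶠ n in atTop, ∃ m ∈ M n, |a n m x| < 1 / ((n : ℝ) + 1) by
    obtain ⟨M, hM, hMx⟩ := H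
    refine ⟨M, hM, fun x ε hε => ?_⟩
    filter_upwards [hMx x,
      tendsto_one_div_add_atTop_nhds_zero_nat.eventually (gt_mem_nhds hε)] with n ⟨m, hm, h1⟩ h2
    exact ⟨m, hm, h1.trans h2⟩
  by_cases hall : ∀ n, HasFinSubcover (range (u n))
  · choose M hM hMx using fun n => (hall n).exists_finite_index
    refine ⟨M, hM, fun x => Eventually.of_forall fun n => ?_⟩
    obtain ⟨m, hm, hx⟩ := hMx n x
    exact ⟨m, hm, hmono le_rfl m x hx⟩
  · push Not at hall
    obtain ⟨n₀, hn₀⟩ := hall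
    have hno : ∀ k, ¬ HasFinSubcover (range (u (n₀ + k))) := by
      intro k hk
      obtain ⟨M, hM, hcov⟩ := hk.exists_finite_index
      refine hn₀ ⟨u n₀ '' M, image_subset_range _ _, hM.image _, eq_univ_of_forall fun x => ?_⟩
      obtain ⟨m, hm, hx⟩ := hcov x
      exact ⟨_, ⟨m, hm, rfl⟩, humono (Nat.le_add_right _ _) m hx⟩
    obtain ⟨𝓕, h𝓕, -, -, hinf, -, hpt⟩ := hX (fun k => range (u (n₀ + k)))
      (fun k => isGammaFCover_range_lt (hgc _) (hglim _) (by positivity) (hno k)) hno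
    have : ∀ k, ∃ M : Set ℕ, M.Finite ∧ u (n₀ + k) '' M = 𝓕 k := fun k => by
      have h1 := (h𝓕 k).1
      rw [← image_univ] at h1
      obtain ⟨M, -, hM, e⟩ := exists_subset_image_finite_and.1 ⟨𝓕 k, h1, (h𝓕 k).2, rfl⟩
      exact ⟨M, hM, e.symm⟩
    choose M hM hMeq using this
    obtain ⟨j, hj, hinj⟩ := exists_strictMono_injective_comp hinf
    refine ⟨fun n => M (j n), fun n => hM _, fun x => ?_⟩
    have hfin : {n | x ∉ ⋃₀ 𝓕 (j n)}.Finite :=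
      ((hpt x).preimage hinj.injOn).subset fun n hn => ⟨⟨j n, rfl⟩, hn⟩
    rw [← Nat.cofinite_eq_atTop]
    have hev : ∀ᶠ n in cofinite, x ∈ ⋃₀ 𝓕 (j n) := hfin
    filter_upwards [hev] with n hn
    rw [← hMeq] at hn
    obtain ⟨_, ⟨m, hm, rfl⟩, hx⟩ := hn
    exact ⟨m, hm, hmono ((hj.id_le n).trans (Nat.le_add_left _ _)) m x hx⟩

theorem UfinGammaFGamma.ffinGammaGamma (hX : UfinGammaFGamma X) : FfinGammaGamma X := by
  intro S hS
  have henum : ∀ n, ∃ e : ℕ → X → ℝ, Function.Injective e ∧ ∀ m, e m ∈ S n := fun n =>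
    ⟨fun m => (hS n).2.2.2.1.natEmbedding _ m,
      Subtype.val_injective.comp ((hS n).2.2.2.1.natEmbedding _).injective, 
      fun m => ((hS n).2.2.2.1.natEmbedding _ m).2⟩
  choose e he heS using henum
  have hlim : ∀ n, Tendsto (e n) atTop (𝓝 0) := by
    intro n U hU
    rw [← Nat.cofinite_eq_atTop]
    exact (((hS n).2.2.2.2 U hU).preimage (he n).injOn).subset fun m hm => ⟨heS n m, hm⟩
  obtain ⟨M, hM, hMx⟩ := hX.exists_finset (fun n m => (hS n).2.1 _ (heS n m))
    fun n => tendsto_pi_nhds.1 (hlim n)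
  refine ⟨fun n => e n '' M n, fun n => ⟨?_, (hM n).image _⟩, fun ε hε K hK => ?_⟩
  · rintro _ ⟨m, -, rfl⟩
    exact heS n m
  · obtain ⟨N, hN⟩ := eventually_atTop.1 ((hK.eventually_all).2 fun x _ => hMx x ε hε)
    refine ⟨N, fun n hn x hx => ?_⟩
    obtain ⟨m, hm, h⟩ := hN n hn.le x hx
    exact ⟨_, ⟨m, hm, rfl⟩, h⟩

/-- Disjoint zero-sets are functionally separated, with a prescribed zero fibre. -/
theorem IsZeroSet.exists_separating {Z W : Set X} (hZ : IsZeroSet Z) (hW : IsZeroSet W)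
    (hd : Disjoint Z W) :
    ∃ f : X → ℝ, Continuous f ∧ (∀ x, f x = 0 ↔ x ∈ Z) ∧ ∀ x ∈ W, f x = 1 := by
  obtain ⟨p, hp, rfl⟩ := hZ
  obtain ⟨q, hq, rfl⟩ := hW
  have hne : ∀ x, |p x| + |q x| ≠ 0 := by
    intro x hx
    have h1 : p x = 0 := abs_eq_zero.1 (by linarith [abs_nonneg (p x), abs_nonneg (q x)])
    have h2 : q x = 0 := abs_eq_zero.1 (by linarith [abs_nonneg (p x), abs_nonneg (q x)])
    exact disjoint_left.1 hd (show x ∈ p ⁻¹' {0} from h1) h2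
  refine ⟨fun x => |p x| / (|p x| + |q x|), hp.abs.div (hp.abs.add hq.abs) hne, fun x => ?_,
    fun x hx => ?_⟩
  · simp [hne x]
  · have hx0 : q x = 0 := hx
    have := hne x
    simp only [hx0, abs_zero, add_zero] at this ⊢
    exact div_self this

/-- A `γ_F`-shrinkable cover carries a null set of functions whose strict sublevel sets at height
one lie in members of the cover. -/
theorem IsGammaFCover.exists_gammaZero {𝒰 : Set (Set X)} (h𝒰 : IsGammaFCover 𝒰) :
    ∃ (S : Set (X → ℝ)) (V : (X → ℝ) → Set X), GammaZero S ∧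
      ∀ f ∈ S, V f ∈ 𝒰 ∧ ∀ x, |f x| < 1 → x ∈ V f := by
  obtain ⟨⟨-, huniv, -⟩, hcoz, F, hF, -, hFinf, -, hFpt⟩ := h𝒰
  have hA (m : ℕ) := (hFinf.natEmbedding _ m).2
  choose U hU hUF using hA
  have hinj : Function.Injective fun m => F (U m) := fun a b hab => by
    simp only [hUF] at hab
    exact (hFinf.natEmbedding _).injective (Subtype.val_injective hab)
  have hsep (m : ℕ) := (hF _ (hU m)).1.exists_separating (hcoz _ (hU m))
    (disjoint_compl_right_iff_subset.2 (hF _ (hU m)).2)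
  choose f hf hf0 hf1 using hsep
  have hfinj : Function.Injective f := fun a b hab => hinj <| by
    ext x
    rw [← hf0, ← hf0, hab]
  refine ⟨range f, fun p => U (Function.invFun f p),
    ⟨countable_range f, ?_, ?_, infinite_range_of_injective hfinj, fun W hW => ?_⟩, ?_⟩
  · rintro _ ⟨m, rfl⟩
    exact hf m
  · rintro ⟨m, hm⟩
    refine huniv ((eq_univ_of_forall fun x => (hF _ (hU m)).2 ((hf0 m x).1 ?_)) ▸ hU m)
    rw [hm, Pi.zero_apply]
  · have hlim : Tendsto f cofinite (𝓝 0) := by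
      refine tendsto_pi_nhds.2 fun x => tendsto_nhds_of_eventually_eq ?_
      refine ((hFpt x).preimage hinj.injOn).subset fun m hm => ?_
      exact ⟨mem_image_of_mem F (hU m), fun hx => hm ((hf0 m x).2 hx)⟩
    refine Finite.subset (Finite.image f (hlim hW)) ?_
    rintro _ ⟨⟨m, rfl⟩, hm⟩
    exact ⟨m, hm, rfl⟩
  · rintro _ ⟨m, rfl⟩
    simp only [Function.leftInverse_invFun hfinj m]
    refine ⟨hU m, fun x hx => ?_⟩
    by_contra hxU
    simp [hf1 m x hxU] at hx

theorem FfinGammaGamma.ufinGammaFGamma (hX : FfinGammaGamma X) : UfinGammaFGamma X := by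
  intro 𝒰 h𝒰 hno
  choose S V hS hV using fun n => (h𝒰 n).exists_gammaZero
  obtain ⟨G, hG, hGx⟩ := hX S hS
  have hsub : ∀ n, V n '' G n ⊆ 𝒰 n := by
    rintro n _ ⟨f, hf, rfl⟩
    exact (hV n f ((hG n).1 hf)).1
  have hev : ∀ x, ∃ N, ∀ n, N < n → x ∈ ⋃₀ (V n '' G n) := by
    intro x
    obtain ⟨N, hN⟩ := hGx 1 one_pos {x} (finite_singleton x)
    refine ⟨N, fun n hn => ?_⟩
    obtain ⟨f, hf, hfx⟩ := hN n hn x rfl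
    exact ⟨_, ⟨f, hf, rfl⟩, (hV n f ((hG n).1 hf)).2 x hfx⟩
  have hne : ∀ n, ⋃₀ (V n '' G n) ≠ univ := fun n h =>
    hno n ⟨_, hsub n, (hG n).2.image _, h⟩
  refine ⟨fun n => V n '' G n, fun n => ⟨hsub n, (hG n).2.image _⟩, ?_, ?_, fun hfin => ?_, ?_,
    fun x => ?_⟩
  · rintro _ ⟨n, rfl⟩
    exact isOpen_sUnion fun U hU => (h𝒰 n).1.1 U (hsub n hU)
  · rintro ⟨n, hn⟩
    exact hne n hn
  · have := hfin.to_subtype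
    obtain ⟨⟨_, k, rfl⟩, hk⟩ := Finite.exists_infinite_fiber
      (rangeFactorization fun n => ⋃₀ (V n '' G n))
    refine hne k (eq_univ_of_forall fun x => ?_)
    obtain ⟨N, hN⟩ := hev x
    obtain ⟨n, hn, hNn⟩ := (infinite_coe_iff.1 hk).exists_gt N
    have hn' : ⋃₀ (V n '' G n) = ⋃₀ (V k '' G k) := congrArg Subtype.val hn
    exact hn' ▸ hN n hNn
  · refine eq_univ_of_forall fun x => ?_
    obtain ⟨N, hN⟩ := hev x
    exact ⟨_, ⟨N + 1, rfl⟩, hN _ N.lt_succ_self⟩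
  · obtain ⟨N, hN⟩ := hev x
    refine ((finite_Iic N).image fun n => ⋃₀ (V n '' G n)).subset ?_
    rintro _ ⟨⟨n, rfl⟩, hn⟩
    refine ⟨n, ?_, rfl⟩
    by_contra hlt
    exact hn (hN n (not_le.1 hlt))

end Helpers

/-- Theorem 4.2: for a Tychonoff space `X`, `C_p(X)` satisfies `F_fin(Γ_0, Γ_0)`
iff `X` satisfies `U_fin(Γ_F, Γ)`. -/
theorem stmt6 (X : Type u) [TopologicalSpace X] [CompletelyRegularSpace X] [T2Space X] :
    FfinGammaGamma X ↔ UfinGammaFGamma X := by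
  exact ⟨FfinGammaGamma.ufinGammaFGamma, UfinGammaFGamma.ffinGammaGamma⟩
end
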